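/- arXiv:2206.10392 — 4 statements merged into one kernel-verified Lean document; each statement's English description precedes it below -/
import Mathlib

section
/- Let h, r, a, b, p, q, e, β be real numbers, let k > 0 and α > 0, and assume HFch₁^β = b − βkr > 0. Set ν := (Fch₂^β − (α²/2)kr)/(b − βkr) and β′ := β + ν. Then the inequality ch₃^{β′} ≤ (α² + ν²)·((1/2)·H²ch₁^{β′} − (h/(3k))·HFch₁^{β′}) holds if and only if the inequality (Fch₂^β − (α²/2)kr)·(Hch₂^β − (h/(3k))·Fch₂^β) ≥ (ch₃^β − (α²/2)·H²ch₁^β + (α²h/(3k))·HFch₁^β)·(b − βkr) holds. (This is the computational equivalence, underlying Theorem 3.8, between inequality (3.3) at relative tilt-slope ν and the Bogomolov–Gieseker type inequality (3.1) of Conjecture 3.6.) -/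
/-- The computational equivalence underlying Theorem 3.8: inequality (3.3) at
relative tilt-slope ν is equivalent to the Bogomolov–Gieseker type inequality
(3.1) of Conjecture 3.6. -/
theorem stmt_0 (h r a b p q e β k α ν β' : ℝ)
    (hk : 0 < k) (hα : 0 < α)
    (hb : 0 < b - β * k * r)
    (hν : ν = (p - β * b + β ^ 2 / 2 * k * r - α ^ 2 / 2 * k * r) / (b - β * k * r))
    (hβ' : β' = β + ν) :
    (e - β' * q + β' ^ 2 / 2 * a - β' ^ 3 / 6 * h * r
        ≤ (α ^ 2 + ν ^ 2) * ((1 / 2) * (a - β' * h * r) - h / (3 * k) * (b - β' * k * r)))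
      ↔
    ((p - β * b + β ^ 2 / 2 * k * r - α ^ 2 / 2 * k * r)
          * ((q - β * a + β ^ 2 / 2 * h * r)
              - h / (3 * k) * (p - β * b + β ^ 2 / 2 * k * r))
        ≥ (e - β * q + β ^ 2 / 2 * a - β ^ 3 / 6 * h * r
              - α ^ 2 / 2 * (a - β * h * r)
              + α ^ 2 * h / (3 * k) * (b - β * k * r)) * (b - β * k * r)) := by
  have hslope : p - β * b + β ^ 2 / 2 * k * r - α ^ 2 / 2 * k * r = ν * (b - β * k * r) := by
    rw [hν, div_mul_cancel₀ _ hb.ne']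
  obtain rfl : p = ν * (b - β * k * r) + β * b - β ^ 2 / 2 * k * r + α ^ 2 / 2 * k * r := by
    linarith
  clear hν hslope
  subst hβ'
  rw [ge_iff_le, ← sub_nonneg, ← mul_nonneg_iff_of_pos_right hb, ← sub_nonneg (b := _ * _)]
  refine iff_of_eq (congrArg (0 ≤ ·) ?_)
  field_simp
  ring
end

section
/- Let r, a, b, p, q, e, β be real numbers, let h ≥ 0, k > 0 and α > 0, and assume Δ̄ := b² − 2krp ≥ 0. If the inequality (Fch₂^β − (α²/2)kr)·(Hch₂^β − (h/(3k))·Fch₂^β) ≥ (ch₃^β − (α²/2)·H²ch₁^β + (α²h/(3k))·HFch₁^β)·HFch₁^β holds, then also (Fch₂^β − (α²/2)kr)·Hch₂^β ≥ (ch₃^β − (α²/2)·H²ch₁^β + (α²h/(4k))·HFch₁^β)·HFch₁^β. (This is the numerical content of Proposition 3.11: the inequality (3.1) of Conjecture 3.6 together with the Bogomolov-type bound Δ̄ ≥ 0 implies the weaker inequality (3.5).) -/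
/-- The numerical content of Proposition 3.11: inequality (3.1) of Conjecture 3.6
together with the Bogomolov-type bound Δ̄ ≥ 0 implies the weaker inequality (3.5). -/
theorem stmt_1 (r a b p q e β h k α : ℝ)
    (hh : 0 ≤ h) (hk : 0 < k) (hα : 0 < α)
    (hΔ : 0 ≤ b ^ 2 - 2 * k * r * p)
    (H31 : (p - β * b + β ^ 2 / 2 * k * r - α ^ 2 / 2 * k * r)
          * ((q - β * a + β ^ 2 / 2 * h * r)
              - h / (3 * k) * (p - β * b + β ^ 2 / 2 * k * r))
        ≥ (e - β * q + β ^ 2 / 2 * a - β ^ 3 / 6 * h * r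
              - α ^ 2 / 2 * (a - β * h * r)
              + α ^ 2 * h / (3 * k) * (b - β * k * r)) * (b - β * k * r)) :
    (p - β * b + β ^ 2 / 2 * k * r - α ^ 2 / 2 * k * r)
        * (q - β * a + β ^ 2 / 2 * h * r)
      ≥ (e - β * q + β ^ 2 / 2 * a - β ^ 3 / 6 * h * r
            - α ^ 2 / 2 * (a - β * h * r)
            + α ^ 2 * h / (4 * k) * (b - β * k * r)) * (b - β * k * r) := by
  have key : 0 ≤ h / (3 * k) * ((p - β * b + β ^ 2 / 2 * k * r) ^ 2
      + α ^ 2 / 4 * (b ^ 2 - 2 * k * r * p)) := by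
    positivity
  have hdiff : h / (3 * k) * ((p - β * b + β ^ 2 / 2 * k * r) ^ 2
      + α ^ 2 / 4 * (b ^ 2 - 2 * k * r * p))
      = (p - β * b + β ^ 2 / 2 * k * r - α ^ 2 / 2 * k * r)
          * (h / (3 * k) * (p - β * b + β ^ 2 / 2 * k * r))
        + (α ^ 2 * h / (3 * k) - α ^ 2 * h / (4 * k)) * (b - β * k * r) ^ 2 := by
    field_simp
    ring
  linarith
end

section
/- Let u, w, w′ ∈ ℝ³ with u₁² − 2u₀u₂ ≥ 0, and assume the cross products u × w and u × w′ are both nonzero. Define the numerical walls W_{u,w} := {(α, β) ∈ ℝ_{>0} × ℝ : (u₂ − βu₁ + ((β² − α²)/2)u₀)(w₁ − βw₀) = (w₂ − βw₁ + ((β² − α²)/2)w₀)(u₁ − βu₀)} and similarly W_{u,w′}. If W_{u,w} ∩ W_{u,w′} ≠ ∅, then W_{u,w} = W_{u,w′}. (This is the numerical content of Proposition 2.16(2), Bertram's nested wall theorem: two numerical walls with respect to a class u with nonnegative discriminant Δ̄(u) = u₁² − 2u₀u₂ that intersect are identical.) -/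
/-- The cross-multiplied slope equation of `u` and `w` depends only on the `2 × 2` minors of
`(u, w)`. -/
lemma numericalWall_iff_minors (u₀ u₁ u₂ w₀ w₁ w₂ a b : ℝ) :
    (u₂ - b * u₁ + (b ^ 2 - a ^ 2) / 2 * u₀) * (w₁ - b * w₀)
        = (w₂ - b * w₁ + (b ^ 2 - a ^ 2) / 2 * w₀) * (u₁ - b * u₀) ↔
      (u₀ * w₁ - u₁ * w₀) * ((a ^ 2 + b ^ 2) / 2) - b * (u₀ * w₂ - u₂ * w₀)
        + (u₁ * w₂ - u₂ * w₁) = 0 := by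
  constructor <;> intro h <;> linear_combination -h

/-- Two vectors annihilated by `(u₀, -u₁, u₂)` and by `((a² + b²) / 2, -b, 1)` are proportional
when `u ≠ 0` has nonnegative discriminant and `a > 0`. -/
lemma minors_proportional {u₀ u₁ u₂ a b A B C A' B' C' : ℝ}
    (hΔ : 0 ≤ u₁ ^ 2 - 2 * u₀ * u₂) (hu : ¬(u₀ = 0 ∧ u₁ = 0 ∧ u₂ = 0)) (ha : 0 < a)
    (hC : u₀ * C - u₁ * B + u₂ * A = 0) (hC' : u₀ * C' - u₁ * B' + u₂ * A' = 0)
    (h : A * ((a ^ 2 + b ^ 2) / 2) - b * B + C = 0)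
    (h' : A' * ((a ^ 2 + b ^ 2) / 2) - b * B' + C' = 0) :
    A * B' = A' * B ∧ A * C' = A' * C ∧ B * C' = B' * C := by
  have key : A * B' - A' * B = 0 := by
    by_contra hk
    have h₁ : u₁ = u₀ * b := by
      apply mul_left_cancel₀ hk
      linear_combination A' * hC - A * hC' - u₀ * A' * h + u₀ * A * h'
    have h₂ : u₂ = u₀ * ((a ^ 2 + b ^ 2) / 2) := by
      apply mul_left_cancel₀ hk
      linear_combination B' * hC - B * hC' - u₀ * B' * h + u₀ * B * h'
    have h₀ : u₀ = 0 := by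
      have : (u₀ * a) ^ 2 ≤ 0 := by
        rw [h₁, h₂] at hΔ
        linarith
      have : u₀ * a = 0 := pow_eq_zero_iff two_ne_zero |>.mp (le_antisymm this (sq_nonneg _))
      exact (mul_eq_zero.mp this).resolve_right ha.ne'
    exact hu ⟨h₀, by rw [h₁, h₀, zero_mul], by rw [h₂, h₀, zero_mul]⟩
  refine ⟨by linear_combination key, ?_, ?_⟩
  · linear_combination b * key + A * h' - A' * h
  · linear_combination ((a ^ 2 + b ^ 2) / 2) * key + B * h' - B' * h

/-- A nonzero vector proportional to a second one: every zero of the first wall equation is a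
zero of the second. -/
lemma wall_eq_of_proportional {A B C A' B' C' : ℝ} (hne : ¬(A = 0 ∧ B = 0 ∧ C = 0))
    (hAB : A * B' = A' * B) (hAC : A * C' = A' * C) (hBC : B * C' = B' * C) {s b : ℝ}
    (h : A * s - b * B + C = 0) : A' * s - b * B' + C' = 0 := by
  by_contra hL
  refine hne ⟨?_, ?_, ?_⟩ <;> apply (mul_eq_zero.mp _).resolve_right hL
  · linear_combination A' * h - b * hAB + hAC
  · linear_combination B' * h - s * hAB + hBC
  · linear_combination C' * h - s * hAC + b * hBC

/-- The numerical content of Proposition 2.16(2), Bertram's nested wall theorem: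
two numerical walls with respect to a class u with Δ̄(u) ≥ 0 that intersect are
identical. -/
theorem stmt_13 (u₀ u₁ u₂ w₀ w₁ w₂ w₀' w₁' w₂' : ℝ)
    (hΔ : 0 ≤ u₁ ^ 2 - 2 * u₀ * u₂)
    (huw : ¬(u₀ * w₁ - u₁ * w₀ = 0 ∧ u₀ * w₂ - u₂ * w₀ = 0 ∧ u₁ * w₂ - u₂ * w₁ = 0))
    (huw' : ¬(u₀ * w₁' - u₁ * w₀' = 0 ∧ u₀ * w₂' - u₂ * w₀' = 0 ∧
      u₁ * w₂' - u₂ * w₁' = 0))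
    (W W' : Set (ℝ × ℝ))
    (hW : W = {x : ℝ × ℝ | 0 < x.1 ∧
      (u₂ - x.2 * u₁ + (x.2 ^ 2 - x.1 ^ 2) / 2 * u₀) * (w₁ - x.2 * w₀)
        = (w₂ - x.2 * w₁ + (x.2 ^ 2 - x.1 ^ 2) / 2 * w₀) * (u₁ - x.2 * u₀)})
    (hW' : W' = {x : ℝ × ℝ | 0 < x.1 ∧
      (u₂ - x.2 * u₁ + (x.2 ^ 2 - x.1 ^ 2) / 2 * u₀) * (w₁' - x.2 * w₀')
        = (w₂' - x.2 * w₁' + (x.2 ^ 2 - x.1 ^ 2) / 2 * w₀') * (u₁ - x.2 * u₀)})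
    (hne : (W ∩ W').Nonempty) :
    W = W' := by
  subst hW hW'
  obtain ⟨⟨a, b⟩, ⟨ha, h⟩, -, h'⟩ := hne
  have hu : ¬(u₀ = 0 ∧ u₁ = 0 ∧ u₂ = 0) := by
    rintro ⟨rfl, rfl, rfl⟩
    exact huw (by simp)
  simp only [numericalWall_iff_minors] at h h' ⊢
  obtain ⟨hAB, hAC, hBC⟩ := minors_proportional hΔ hu ha (by ring) (by ring) h h'
  ext x
  exact and_congr_right fun _ =>
    ⟨wall_eq_of_proportional huw hAB hAC hBC,
      wall_eq_of_proportional huw' (by linarith) (by linarith) (by linarith)⟩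
end

section
/- Let u = (u₀, u₁, u₂) ∈ ℝ³, α > 0 and β ∈ ℝ with u₁ − βu₀ ≠ 0. Set ν := (u₂ − βu₁ + ((β² − α²)/2)u₀)/(u₁ − βu₀), s := β + ν and ρ := α² + ν². Then for every (α′, β′) ∈ ℝ_{>0} × ℝ with (β′ − s)² + α′² = ρ one has u₂ − β′u₁ + ((β′² − α′²)/2)·u₀ = (s − β′)·(u₁ − β′u₀); in particular, at every point of this semicircle where u₁ − β′u₀ ≠ 0, the relative tilt-slope of u equals s − β′. (This is the numerical content of Proposition 2.16(3): along the semicircle C_{α,β} with center (0, β + ν^{α,β}(u)) and radius √(α² + ν^{α,β}(u)²), the slope of u is determined by the center.) -/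
/-- The numerical content of Proposition 2.16(3): along the semicircle with
center (0, β + ν) and radius √(α² + ν²), the relative tilt-slope of u equals
s − β', where s is the center. -/
theorem stmt_14 (u₀ u₁ u₂ α β ν s ρ : ℝ) (hα : 0 < α)
    (hu : u₁ - β * u₀ ≠ 0)
    (hν : ν = (u₂ - β * u₁ + (β ^ 2 - α ^ 2) / 2 * u₀) / (u₁ - β * u₀))
    (hs : s = β + ν) (hρ : ρ = α ^ 2 + ν ^ 2) :
    ∀ α' β' : ℝ, 0 < α' → (β' - s) ^ 2 + α' ^ 2 = ρ →
      u₂ - β' * u₁ + (β' ^ 2 - α' ^ 2) / 2 * u₀ = (s - β') * (u₁ - β' * u₀)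
        ∧ (u₁ - β' * u₀ ≠ 0 →
          (u₂ - β' * u₁ + (β' ^ 2 - α' ^ 2) / 2 * u₀) / (u₁ - β' * u₀) = s - β') := by
  intro α' β' _ hcircle
  rw [eq_div_iff hu] at hν
  subst hs hρ
  have hslope : u₂ - β' * u₁ + (β' ^ 2 - α' ^ 2) / 2 * u₀
      = (β + ν - β') * (u₁ - β' * u₀) := by
    linear_combination -hν - u₀ / 2 * hcircle
  exact ⟨hslope, fun hne => (div_eq_iff hne).mpr hslope⟩
end
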